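/- arXiv:math/0312509 — 2 statements merged into one kernel-verified Lean document; each statement's English description precedes it below -/
import Mathlib

section
/- Let G be a group, S(X) = 1 a system over G with a solution in G, and T(X,Y) = 1 a system compatible with S(X) = 1 over G which admits an S-lift. Regard G_{R(S ∪ T)} as a G_{R(S)}-group via the canonical embedding G_{R(S)} → G_{R(S ∪ T)}. Then: (a) the identity map on Y induces a canonical surjective G_{R(S)}-homomorphism ψ* : G_{R(S ∪ T)} → G_{R(S)}[Y]/Rad_{G_{R(S)}}(T(X^μ,Y)), onto the coordinate group of the system T(X^μ,Y) = 1 over G_{R(S)}; (b) every solution U of T(X^μ,Y) = 1 in G_{R(S)} gives rise to a G_{R(S)}-homomorphism φ_U : G_{R(S ∪ T)} → G_{R(S)} with φ_U(Y) = U. -/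
open Monoid

universe u v w

namespace KM

variable {G : Type u} [Group G] {K : Type w} [Group K] {X : Type v}

/-- `G[X] = G ∗ F(X)`, the free product of `G` and the free group `F(X)` on the set of
variables `X`. -/
abbrev GX (G : Type u) [Group G] (X : Type v) : Type (max u v) :=
  Monoid.Coprod G (FreeGroup X)

/-- The embedding of the constants `G` into `G[X]`. -/
def const : G →* GX G X := Monoid.Coprod.inl

/-- The variable `x` as an element of `G[X]`. -/
def varg (x : X) : GX G X := Monoid.Coprod.inr (FreeGroup.of x)

/-- Evaluation of the words of `G[X]` in a `G`-group `K` (with structural morphism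
`μ : G →* K`) at a tuple `g : X → K`: the induced homomorphism `G[X] →* K` which is `μ` on
the constants and sends `x` to `g x`. -/
def evalIn (μ : G →* K) (g : X → K) : GX G X →* K :=
  Monoid.Coprod.lift μ (FreeGroup.lift g)

/-- Evaluation of the words of `G[X]` in `G` at a tuple `g : X → G`. -/
def eval (g : X → G) : GX G X →* G := evalIn (MonoidHom.id G) g

/-- `g : X → G` is a solution in `G` of the system of equations `S = 1` over `G`. -/
def IsSolution (S : Set (GX G X)) (g : X → G) : Prop := ∀ s ∈ S, eval g s = 1

/-- The radical `R(S)` of a system of equations `S = 1` over `G`: the set of all words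
vanishing at every solution of `S = 1` in `G` (all of `G[X]` if there are no solutions). -/
def radical (S : Set (GX G X)) : Subgroup (GX G X) where
  carrier := {w | ∀ g : X → G, IsSolution S g → eval g w = 1}
  one_mem' := fun _ _ => map_one _
  mul_mem' := fun ha hb g hg => by rw [map_mul, ha g hg, hb g hg, one_mul]
  inv_mem' := fun ha g hg => by rw [map_inv, ha g hg, inv_one]

theorem mem_radical {S : Set (GX G X)} {w : GX G X} :
    w ∈ radical S ↔ ∀ g : X → G, IsSolution S g → eval g w = 1 := Iff.rfl

instance radical_normal (S : Set (GX G X)) : (radical S).Normal := by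
  constructor
  intro w hw g x hx
  have h1 : eval x w = 1 := hw x hx
  simp [map_mul, map_inv, h1]

/-- The coordinate group `G_{R(S)} = G[X]/R(S)` of the system `S = 1` over `G`. -/
abbrev CoordGroup (S : Set (GX G X)) : Type max u v := GX G X ⧸ radical S

/-- The canonical projection `G[X] → G_{R(S)}`. -/
def toCoord (S : Set (GX G X)) : GX G X →* CoordGroup S := QuotientGroup.mk' (radical S)

/-- The canonical map `μ : G → G_{R(S)}`. -/
def coordConst (S : Set (GX G X)) : G →* CoordGroup S := (toCoord S).comp const

variable {Y : Type v}

/-- The canonical embedding `G[X] → G[X ∪ Y]`. -/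
def inclL : GX G X →* GX G (X ⊕ Y) :=
  Monoid.Coprod.lift Monoid.Coprod.inl
    (FreeGroup.lift fun x => Monoid.Coprod.inr (FreeGroup.of (Sum.inl x)))

theorem eval_inclL (g : X ⊕ Y → G) (w : GX G X) :
    eval g (inclL (Y := Y) w) = eval (g ∘ Sum.inl) w := by
  have h : (eval g).comp (inclL (G := G) (X := X) (Y := Y)) = eval (g ∘ Sum.inl) := by
    apply Monoid.Coprod.hom_ext
    · ext c
      simp [eval, evalIn, inclL]
    · ext x
      simp [eval, evalIn, inclL]
  exact DFunLike.congr_fun h w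

/-- The canonical `G`-homomorphism `λ* : G_{R(S)} → G_{R(S ∪ T)}` induced by the map
`X → G[X ∪ Y]`. -/
def lamStar (S : Set (GX G X)) (T : Set (GX G (X ⊕ Y))) :
    CoordGroup S →* CoordGroup (⇑(inclL (Y := Y)) '' S ∪ T) :=
  QuotientGroup.map _ _ inclL (by
    intro w hw
    rw [Subgroup.mem_comap, mem_radical]
    intro g hg
    rw [eval_inclL]
    refine hw (g ∘ Sum.inl) (fun s hs => ?_)
    have h := hg (inclL s) (Or.inl ⟨s, hs, rfl⟩)
    rwa [eval_inclL] at h)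

/-- Substitution of the canonical images `X^μ ∈ G_{R(S)}` of the variables `X` (regarded
as constants) for `X`: the canonical homomorphism `G[X ∪ Y] → G_{R(S)}[Y]` sending a word
`T(X,Y)` to the word `T(X^μ,Y)` over `G_{R(S)}`. -/
def substMap (S : Set (GX G X)) : GX G (X ⊕ Y) →* GX (CoordGroup S) Y :=
  Monoid.Coprod.lift (Monoid.Coprod.inl.comp (coordConst S))
    (FreeGroup.lift (Sum.elim (fun x => Monoid.Coprod.inl ((toCoord S) (varg x)))
      (fun y => Monoid.Coprod.inr (FreeGroup.of y))))

/-- The homomorphism `G_{R(S)} → G` induced by a solution `g` of `S = 1` in `G`. -/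
def coordEval {S : Set (GX G X)} {g : X → G} (hg : IsSolution S g) : CoordGroup S →* G :=
  QuotientGroup.lift (radical S) (eval g) fun _ hw => hw g hg

theorem coordEval_toCoord {S : Set (GX G X)} {g : X → G} (hg : IsSolution S g) (w : GX G X) :
    coordEval hg (toCoord S w) = eval g w := rfl

theorem toCoord_surjective (S : Set (GX G X)) : Function.Surjective (toCoord S) :=
  QuotientGroup.mk'_surjective _

theorem substMap_inclL (S : Set (GX G X)) (w : GX G X) :
    substMap (Y := Y) S (inclL w) = Monoid.Coprod.inl (toCoord S w) := by
  have h : (substMap (Y := Y) S).comp inclL = Monoid.Coprod.inl.comp (toCoord S) := by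
    apply Monoid.Coprod.hom_ext
    · ext c
      simp [substMap, inclL, coordConst, const]
    · ext x
      simp [substMap, inclL, varg]
  exact DFunLike.congr_fun h w

theorem substMap_varg_inr (S : Set (GX G X)) (y : Y) :
    substMap (Y := Y) S (varg (Sum.inr y)) = varg y := by
  simp [substMap, varg]

theorem substMap_surjective (S : Set (GX G X)) :
    Function.Surjective (substMap (Y := Y) S) := by
  intro z
  induction z using Monoid.Coprod.induction_on with
  | inl h =>
    obtain ⟨w, rfl⟩ := toCoord_surjective S h
    exact ⟨inclL w, substMap_inclL S w⟩
  | inr f =>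
    refine ⟨Monoid.Coprod.inr (FreeGroup.map Sum.inr f), ?_⟩
    have h : ((substMap (Y := Y) S).comp Monoid.Coprod.inr).comp (FreeGroup.map Sum.inr) =
        Monoid.Coprod.inr := by
      ext y
      simp [substMap]
    exact DFunLike.congr_fun h f
  | mul a b ha hb =>
    obtain ⟨a, rfl⟩ := ha
    obtain ⟨b, rfl⟩ := hb
    exact ⟨a * b, map_mul _ _ _⟩

/-- Specializing a word `w(X^μ, U)` of `G_{R(S)}` at a solution `g` of `S = 1` gives the value
of `w` at the tuple `(g, U(g))`. -/
theorem coordEval_eval_substMap {S : Set (GX G X)} {g : X → G} (hg : IsSolution S g)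
    (U : Y → CoordGroup S) (w : GX G (X ⊕ Y)) :
    coordEval hg (eval U (substMap S w)) = eval (Sum.elim g (coordEval hg ∘ U)) w := by
  have h : ((coordEval hg).comp (eval U)).comp (substMap S) =
      eval (Sum.elim g (coordEval hg ∘ U)) := by
    apply Monoid.Coprod.hom_ext
    · ext c
      simp [substMap, eval, evalIn, coordConst, const, coordEval_toCoord]
    · ext z
      cases z <;> simp [substMap, eval, evalIn, varg, coordEval_toCoord]
  exact DFunLike.congr_fun h w

/-- The words in `R(S ∪ T)` vanish at `(X^μ, U)` for every solution `U` of `T(X^μ, Y) = 1`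
in `G_{R(S)}`. -/
theorem eval_substMap_eq_one {S : Set (GX G X)} {T : Set (GX G (X ⊕ Y))}
    {U : Y → CoordGroup S} (hU : ∀ t ∈ T, eval U (substMap S t) = 1) {w : GX G (X ⊕ Y)}
    (hw : w ∈ radical (⇑(inclL (Y := Y)) '' S ∪ T)) : eval U (substMap S w) = 1 := by
  obtain ⟨v, hv⟩ := toCoord_surjective S (eval U (substMap S w))
  rw [← hv]
  refine (QuotientGroup.eq_one_iff v).2 fun g hg => ?_
  rw [← coordEval_toCoord hg, hv, coordEval_eval_substMap]
  refine hw _ ?_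
  rintro _ (⟨s, hs, rfl⟩ | ht)
  · rw [eval_inclL, Sum.elim_comp_inl]
    exact hg s hs
  · rw [← coordEval_eval_substMap, hU _ ht, map_one]

/-- Let `S(X) = 1` have a solution in `G`, and let `T(X,Y) = 1` be compatible with
`S(X) = 1` and admit an `S`-lift.  Write `H = G_{R(S)}`.  Then:
(a) the identity map on `Y` induces a canonical surjective `H`-homomorphism
`ψ* : G_{R(S ∪ T)} → H[Y]/Rad_H(T(X^μ,Y))` onto the coordinate group of the system
`T(X^μ,Y) = 1` over `H`, and
(b) every solution `U` of `T(X^μ,Y) = 1` in `H` gives rise to an `H`-homomorphism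
`φ_U : G_{R(S ∪ T)} → H` with `φ_U(Y) = U`. -/
theorem lift_gives_epimorphism_and_homomorphisms {G : Type u} [Group G] {X Y : Type v}
    (S : Set (GX G X)) (T : Set (GX G (X ⊕ Y)))
    (hS : ∃ U : X → G, IsSolution S U)
    (hcompat : ∀ U : X → G, IsSolution S U →
      ∃ B : Y → G, ∀ t ∈ T, eval (Sum.elim U B) t = 1)
    (hlift : ∃ Y₀ : Y → CoordGroup S, ∀ t ∈ T, eval Y₀ (substMap S t) = 1) :
    (∃ Ψ : CoordGroup (⇑(inclL (Y := Y)) '' S ∪ T) →*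
        CoordGroup (⇑(substMap S (Y := Y)) '' T),
      Function.Surjective Ψ ∧
      (∀ w : GX G X,
        Ψ (toCoord (⇑(inclL (Y := Y)) '' S ∪ T) (inclL w)) =
          toCoord (⇑(substMap S (Y := Y)) '' T) (Monoid.Coprod.inl (toCoord S w))) ∧
      (∀ y : Y,
        Ψ (toCoord (⇑(inclL (Y := Y)) '' S ∪ T) (varg (Sum.inr y))) =
          toCoord (⇑(substMap S (Y := Y)) '' T) (varg y))) ∧
    (∀ U : Y → CoordGroup S, (∀ t ∈ T, eval U (substMap S t) = 1) →
      ∃ φU : CoordGroup (⇑(inclL (Y := Y)) '' S ∪ T) →* CoordGroup S,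
        (∀ w : GX G X, φU (toCoord (⇑(inclL (Y := Y)) '' S ∪ T) (inclL w)) = toCoord S w) ∧
        (∀ y : Y, φU (toCoord (⇑(inclL (Y := Y)) '' S ∪ T) (varg (Sum.inr y))) = U y)) := by
  refine ⟨⟨QuotientGroup.map _ _ (substMap S) fun w hw U hU =>
      eval_substMap_eq_one (fun t ht => hU _ ⟨t, ht, rfl⟩) hw, ?_, ?_, ?_⟩, fun U hU =>
    ⟨QuotientGroup.lift _ ((eval U).comp (substMap S)) fun w hw => eval_substMap_eq_one hU hw,
      ?_, ?_⟩⟩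
  · intro z
    obtain ⟨z, rfl⟩ := toCoord_surjective _ z
    obtain ⟨w, rfl⟩ := substMap_surjective S z
    exact ⟨toCoord _ w, rfl⟩
  · intro w
    exact congrArg (toCoord _) (substMap_inclL S w)
  · intro y
    exact congrArg (toCoord _) (substMap_varg_inr S y)
  · intro w
    change eval U (substMap S (inclL w)) = _
    rw [substMap_inclL]
    simp [eval, evalIn]
  · intro y
    change eval U (substMap S (varg (Sum.inr y))) = _
    rw [substMap_varg_inr]
    simp [eval, evalIn, varg]

end KM
end

section
/- Let G be a group and S(X) = 1 an equation over G which has a solution in G. For an arbitrary equation T(X,Y) = 1 over G the following are equivalent: (1) T(X,Y) = 1 is compatible with S(X) = 1 over G and T(X,Y) = 1 admits an S-lift; (2) G_{R(S)} is a retract of G_{R(S ∪ T)}: the canonical G-homomorphism λ* : G_{R(S)} → G_{R(S ∪ T)} is injective, and there exists a G_{R(S)}-homomorphism ρ : G_{R(S ∪ T)} → G_{R(S)} (i.e. ρ composed after λ* is the identity of G_{R(S)}). -/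
open Monoid

universe u v w

namespace KM

variable {G : Type u} [Group G] {K : Type w} [Group K] {X : Type v}

variable {Y : Type v}

/-- The homomorphism `G_{R(S)} → G` given by evaluation at a solution of `S = 1` in `G`. -/
def evalCoord {S : Set (GX G X)} (U : X → G) (hU : IsSolution S U) : CoordGroup S →* G :=
  QuotientGroup.lift (radical S) (eval U) fun _ hw => hw U hU

theorem evalCoord_toCoord {S : Set (GX G X)} (U : X → G) (hU : IsSolution S U) (w : GX G X) :
    evalCoord U hU (toCoord S w) = eval U w := rfl

theorem toCoord_eq_one_iff {S : Set (GX G X)} {w : GX G X} :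
    toCoord S w = 1 ↔ w ∈ radical S := QuotientGroup.eq_one_iff w

/-- Solutions of `S = 1` in `G` separate the elements of `G_{R(S)}`. -/
theorem eq_one_of_evalCoord {S : Set (GX G X)} {a : CoordGroup S}
    (h : ∀ (U : X → G) (hU : IsSolution S U), evalCoord U hU a = 1) : a = 1 := by
  obtain ⟨w, rfl⟩ := QuotientGroup.mk'_surjective _ a
  exact toCoord_eq_one_iff.2 h

theorem eval_substMap_inclL (S : Set (GX G X)) (Y₀ : Y → CoordGroup S) (w : GX G X) :
    eval Y₀ (substMap S (inclL w)) = toCoord S w := by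
  have h : ((eval Y₀).comp (substMap S)).comp inclL = toCoord S := by
    apply Monoid.Coprod.hom_ext
    · ext c
      simp [eval, evalIn, inclL, substMap, coordConst, const]
    · ext x
      simp [eval, evalIn, inclL, substMap, varg]
  exact DFunLike.congr_fun h w

theorem evalCoord_eval_substMap {S : Set (GX G X)} (U : X → G) (hU : IsSolution S U)
    (Y₀ : Y → CoordGroup S) (w : GX G (X ⊕ Y)) :
    evalCoord U hU (eval Y₀ (substMap S w)) =
      eval (Sum.elim U fun y => evalCoord U hU (Y₀ y)) w := by
  have h : (evalCoord U hU).comp ((eval Y₀).comp (substMap S)) =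
      eval (Sum.elim U fun y => evalCoord U hU (Y₀ y)) := by
    apply Monoid.Coprod.hom_ext
    · ext c
      simp [eval, evalIn, substMap, coordConst, const, evalCoord_toCoord]
    · ext z
      cases z <;> simp [eval, evalIn, substMap, varg, evalCoord_toCoord]
  exact DFunLike.congr_fun h w

theorem inclL_const (c : G) : inclL (Y := Y) (const (X := X) c) = const c := by
  simp [inclL, const]

theorem inclL_varg (x : X) : inclL (G := G) (Y := Y) (varg x) = varg (Sum.inl x) := by
  simp [inclL, varg]

/-- A `G_{R(S)}`-homomorphism from `G_{R(S ∪ T)}` to `G_{R(S)}` is evaluation at the images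
of the variables `Y`. -/
theorem retraction_toCoord {S : Set (GX G X)} {T : Set (GX G (X ⊕ Y))}
    (ρ : CoordGroup (⇑(inclL (Y := Y)) '' S ∪ T) →* CoordGroup S)
    (hρ : ρ.comp (lamStar S T) = MonoidHom.id _) (w : GX G (X ⊕ Y)) :
    ρ (toCoord _ w) = eval (fun y => ρ (toCoord _ (varg (Sum.inr y)))) (substMap S w) := by
  have hl (v : GX G X) : ρ (toCoord _ (inclL v)) = toCoord S v :=
    DFunLike.congr_fun hρ (toCoord S v)
  have h : ρ.comp (toCoord _) =
      (eval fun y => ρ (toCoord _ (varg (Sum.inr y)))).comp (substMap S) := by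
    apply Monoid.Coprod.hom_ext
    · ext c
      have h := hl (const c)
      rw [inclL_const] at h
      exact h.trans (by simp [eval, evalIn, substMap, coordConst, const])
    · ext z
      cases z with
      | inl x =>
        have h := hl (varg x)
        rw [inclL_varg] at h
        exact h.trans (by simp [eval, evalIn, substMap, varg])
      | inr y => simp [eval, evalIn, substMap, varg]
  exact DFunLike.congr_fun h w

theorem isSolution_image_union {S : Set (GX G X)} {T : Set (GX G (X ⊕ Y))} {U : X → G}
    {B : Y → G} (hU : IsSolution S U) (hB : IsSolution T (Sum.elim U B)) :
    IsSolution (⇑(inclL (Y := Y)) '' S ∪ T) (Sum.elim U B) := by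
  rintro _ (⟨s, hs, rfl⟩ | ht)
  · rw [eval_inclL, Sum.elim_comp_inl]
    exact hU s hs
  · exact hB _ ht

theorem injective_lamStar {S : Set (GX G X)} {T : Set (GX G (X ⊕ Y))}
    (h : ∀ U : X → G, IsSolution S U → ∃ B : Y → G, IsSolution T (Sum.elim U B)) :
    Function.Injective (lamStar S T) := by
  rw [injective_iff_map_eq_one]
  intro a ha
  obtain ⟨w, rfl⟩ := QuotientGroup.mk'_surjective _ a
  refine toCoord_eq_one_iff.2 fun U hU => ?_
  obtain ⟨B, hB⟩ := h U hU
  have h1 := toCoord_eq_one_iff.1 ha _ (isSolution_image_union hU hB)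
  rwa [eval_inclL, Sum.elim_comp_inl] at h1

theorem exists_retraction {S : Set (GX G X)} {T : Set (GX G (X ⊕ Y))} (Y₀ : Y → CoordGroup S)
    (hY₀ : ∀ t ∈ T, eval Y₀ (substMap S t) = 1) :
    ∃ ρ : CoordGroup (⇑(inclL (Y := Y)) '' S ∪ T) →* CoordGroup S,
      ρ.comp (lamStar S T) = MonoidHom.id _ := by
  refine ⟨QuotientGroup.lift _ ((eval Y₀).comp (substMap S)) fun w hw => ?_, ?_⟩
  · refine eq_one_of_evalCoord fun U hU => ?_
    rw [MonoidHom.comp_apply, evalCoord_eval_substMap]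
    refine hw _ (isSolution_image_union hU fun t ht => ?_)
    rw [← evalCoord_eval_substMap, hY₀ t ht, map_one]
  · refine MonoidHom.ext fun a => ?_
    obtain ⟨w, rfl⟩ := QuotientGroup.mk'_surjective _ a
    exact eval_substMap_inclL S Y₀ w

/-- Let `S(X) = 1` be an equation over `G` with a solution in `G`, and `T(X,Y) = 1` an
arbitrary equation over `G`.  Then the following are equivalent:
(1) `T = 1` is compatible with `S = 1` over `G` and `T = 1` admits an `S`-lift;
(2) `G_{R(S)}` is a retract of `G_{R(S ∪ T)}`: the canonical `G`-homomorphism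
`λ* : G_{R(S)} → G_{R(S ∪ T)}` is injective and there is a `G_{R(S)}`-homomorphism
`ρ : G_{R(S ∪ T)} → G_{R(S)}`, i.e. `ρ ∘ λ* = id`. -/
theorem lift_iff_retract {G : Type u} [Group G] {X Y : Type v}
    (S : GX G X) (T : GX G (X ⊕ Y))
    (hS : ∃ U : X → G, eval U S = 1) :
    ((∀ U : X → G, eval U S = 1 → ∃ B : Y → G, eval (Sum.elim U B) T = 1) ∧
      (∃ Y₀ : Y → CoordGroup ({S} : Set (GX G X)),
        eval Y₀ (substMap {S} T) = 1)) ↔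
    (Function.Injective (lamStar ({S} : Set (GX G X)) ({T} : Set (GX G (X ⊕ Y)))) ∧
      ∃ ρ : CoordGroup (⇑(inclL (Y := Y)) '' {S} ∪ {T}) →* CoordGroup ({S} : Set (GX G X)),
        ρ.comp (lamStar {S} {T}) = MonoidHom.id (CoordGroup ({S} : Set (GX G X)))) := by
  have hsol (U : X → G) : IsSolution {S} U ↔ eval U S = 1 := by simp [IsSolution]
  constructor
  · rintro ⟨hc, Y₀, hY₀⟩
    refine ⟨injective_lamStar fun U hU => ?_, exists_retraction Y₀ (by simpa using hY₀)⟩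
    obtain ⟨B, hB⟩ := hc U ((hsol U).1 hU)
    exact ⟨B, by simpa [IsSolution] using hB⟩
  · rintro ⟨-, ρ, hρ⟩
    obtain ⟨Y₀, hY₀⟩ : ∃ Y₀ : Y → CoordGroup ({S} : Set (GX G X)),
        eval Y₀ (substMap {S} T) = 1 := by
      refine ⟨_, (retraction_toCoord ρ hρ T).symm.trans ?_⟩
      rw [toCoord_eq_one_iff.2 fun g hg => hg T (Or.inr rfl), map_one]
    refine ⟨fun U hU => ⟨fun y => evalCoord U ((hsol U).2 hU) (Y₀ y), ?_⟩, Y₀, hY₀⟩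
    rw [← evalCoord_eval_substMap, hY₀, map_one]

end KM
end
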